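/- Monotonicity lemma: with the notation above, let Λ be a real interval with Λ ∩ σ_ess(A_N) = ∅ and let v ∈ H¹_A satisfy χ_Λ(A_N)P'_N(0)v = 0. Then P'_N(λ)v ∈ G_λ for all λ ∈ Λ, and the function λ ↦ b[P'_N(λ)v] is nondecreasing on Λ; explicitly b[P'_N(λ)v] = b[P'_N(0)v] + λ‖P'_N(0)v‖² + λ²(R_N(λ)P'_N(0)v, P'_N(0)v). If moreover v ∉ D(A_N), the function is strictly increasing. -/

import Mathlib

noncomputable section

open scoped InnerProductSpace

local notation "⟪" x ", " y "⟫" => @inner ℂ _ _ x y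

variable {H H1 : Type*} [NormedAddCommGroup H] [InnerProductSpace ℂ H] [CompleteSpace H]
  [NormedAddCommGroup H1] [InnerProductSpace ℂ H1] [CompleteSpace H1]

/-- `MemA J H0 u f` says that `u` belongs to the domain `H¹_A` of the maximal
operator `A` (i.e. the functional `v ↦ a[u,v]` on `H0` is `H`-continuous) and
`A u = f`:  `a[u, v] = (f, v)` for all `v ∈ H0`. -/
def MemA (J : H1 →L[ℂ] H) (H0 : Submodule ℂ H1) (u : H1) (f : H) : Prop :=
  ∀ v ∈ H0, ⟪u, (v : H1)⟫ = ⟪f, J v⟫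

open Filter Topology in
/-- Weyl singular-sequence characterization of `λ ∈ σ_ess(A_N)` via the bounded
inverse `K = J ∘ TN = A_N⁻¹`. -/
def InEssSpec (K : H →L[ℂ] H) (lam : ℝ) : Prop :=
  ∃ x : ℕ → H, (∀ n, ‖x n‖ = 1) ∧
    (∀ y : H, Tendsto (fun n => (⟪y, x n⟫ : ℂ)) atTop (𝓝 0)) ∧
    Tendsto (fun n => ‖x n - (lam : ℂ) • K (x n)‖) atTop (𝓝 0)

section helpers

open Filter Topology

theorem aux_uniq (E K : H →L[ℂ] H) (l : ℝ)
    (hE1 : ∀ x : H, E x = x ↔ (l : ℂ) • K x = x) (d : H) (hd : E d = 0)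
    (h : d = (l : ℂ) • K d) : d = 0 := by
  rw [← (hE1 d).2 h.symm, hd]

theorem aux_core (K : H →L[ℂ] H) (E S : ℝ → (H →L[ℂ] H)) (Λ : Set ℝ) (hΛ : Λ.OrdConnected)
    (hK : ∀ u z : H, ⟪K u, z⟫ = ⟪u, K z⟫)
    (hE1 : ∀ (l : ℝ) (x : H), E l x = x ↔ (l : ℂ) • K x = x)
    (hE2 : ∀ (l : ℝ) (f : H), (l : ℂ) • E l (K f) = E l f)
    (hS1 : ∀ l ∈ Λ, ∀ g : H, E l g = 0 → S l g = g + (l : ℂ) • K (S l g))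
    (hS2 : ∀ l ∈ Λ, ∀ g : H, E l g = 0 → E l (S l g) = 0)
    (x : H) (hx : ∀ l ∈ Λ, E l x = 0) (c : ℝ) (F : ℝ → ℝ)
    (hF : ∀ l ∈ Λ, F l = c + l * (⟪x, S l x⟫).re) :
    MonotoneOn F Λ ∧ (x ≠ 0 → StrictMonoOn F Λ) := by
  have hy : ∀ l ∈ Λ, S l x = x + (l : ℂ) • K (S l x) := fun l hl => hS1 l hl x (hx l hl)
  have hEy : ∀ l ∈ Λ, ∀ m ∈ Λ, E l (S m x) = 0 := by
    intro l hl m hm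
    by_cases hlm : l = m
    · subst hlm; exact hS2 l hl x (hx l hl)
    have h1 : E l (S m x) = (m : ℂ) • E l (K (S m x)) := by
      conv_lhs => rw [hy m hm]
      simp [hx l hl]
    have h2 := hE2 l (S m x)
    have h3 : ((l : ℂ) - m) • E l (S m x) = 0 := by
      rw [sub_smul]
      nth_rewrite 1 [h1]
      rw [smul_comm, h2, sub_self]
    rcases smul_eq_zero.1 h3 with h | h
    · exact absurd (by exact_mod_cast sub_eq_zero.1 h) hlm
    · exact h
  have hdiff : ∀ l ∈ Λ, ∀ m ∈ Λ, S m x - S l x = S l (((m : ℂ) - l) • K (S m x)) := by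
    intro l hl m hm
    set d := S m x - S l x with hd
    have hEd : E l d = 0 := by rw [hd, map_sub, hEy l hl m hm, hEy l hl l hl, sub_zero]
    have hg : d - (l : ℂ) • K d = ((m : ℂ) - l) • K (S m x) := by
      have a1 := hy m hm
      have a2 := hy l hl
      have : d = (m : ℂ) • K (S m x) - (l : ℂ) • K (S l x) := by
        calc d = (x + (m : ℂ) • K (S m x)) - (x + (l : ℂ) • K (S l x)) := by rw [← a1, ← a2]
          _ = _ := by abel
      nth_rewrite 1 [this]
      rw [hd, map_sub, smul_sub, sub_smul]
      abel
    have hEg : E l (((m : ℂ) - l) • K (S m x)) = 0 := by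
      rw [← hg, map_sub, map_smul, hE2, sub_self]
    have b1 := hS1 l hl _ hEg
    have b2 := hS2 l hl _ hEg
    rw [← sub_eq_zero]
    apply aux_uniq (E l) K l (hE1 l)
    · rw [map_sub, hEd, b2, sub_zero]
    · rw [map_sub, smul_sub, sub_eq_sub_iff_sub_eq_sub, hg]
      exact eq_sub_of_add_eq b1.symm
  have hbd : ∀ l ∈ Λ, ∀ m ∈ Λ, ‖S m x - S l x‖ ≤ |m - l| * (‖S l‖ * ‖K‖) * ‖S m x‖ := by
    intro l hl m hm
    rw [hdiff l hl m hm]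
    have e : ‖((m : ℂ) - l)‖ = |m - l| := by
      rw [← Complex.ofReal_sub, Complex.norm_real, Real.norm_eq_abs]
    calc _ ≤ ‖S l‖ * (‖((m : ℂ) - l)‖ * (‖K‖ * ‖S m x‖)) := by
          refine (ContinuousLinearMap.le_opNorm _ _).trans ?_
          rw [norm_smul]
          gcongr
          exact ContinuousLinearMap.le_opNorm _ _
      _ = _ := by rw [e]; ring
  have hcont : ∀ l ∈ Λ, Tendsto (fun m => S m x) (𝓝[Λ] l) (𝓝 (S l x)) := by
    intro l hl
    set C := ‖S l‖ * ‖K‖ with hC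
    have t0 : Tendsto (fun m : ℝ => |m - l|) (𝓝[Λ] l) (𝓝 0) := by
      have : Continuous (fun m : ℝ => |m - l|) := by fun_prop
      have h := (this.tendsto l).mono_left (nhdsWithin_le_nhds (s := Λ))
      simpa using h
    have t1 : Tendsto (fun m : ℝ => |m - l| * C) (𝓝[Λ] l) (𝓝 0) := by
      simpa using t0.mul_const C
    have t2 : Tendsto (fun m : ℝ => |m - l| * C * (2 * ‖S l x‖)) (𝓝[Λ] l) (𝓝 0) := by
      simpa using t1.mul_const (2 * ‖S l x‖)
    rw [tendsto_iff_norm_sub_tendsto_zero]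
    refine squeeze_zero' (Eventually.of_forall fun _ => norm_nonneg _) ?_ t2
    filter_upwards [t1.eventually (gt_mem_nhds (show (0:ℝ) < 1/2 by norm_num)),
      self_mem_nhdsWithin] with m hm hmΛ
    have h1 := hbd l hl m hmΛ
    have h2 : ‖S m x‖ ≤ ‖S l x‖ + ‖S m x - S l x‖ := by
      have := norm_add_le (S l x) (S m x - S l x)
      rwa [add_sub_cancel] at this
    have h3 : |m - l| * C * ‖S m x‖ ≤ 1/2 * ‖S m x‖ := by gcongr
    refine h1.trans ?_
    have hCn : 0 ≤ C := by positivity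
    gcongr
    linarith
  have hFd : ∀ l ∈ Λ, ∀ m ∈ Λ, F m - F l = (m - l) * (⟪S l x, S m x⟫).re := by
    intro l hl m hm
    rw [hF l hl, hF m hm]
    have e1 : ⟪x, S m x⟫ = ⟪S l x, S m x⟫ - l * ⟪S l x, K (S m x)⟫ := by
      have : x = S l x - (l : ℂ) • K (S l x) :=
        eq_sub_of_add_eq (hy l hl).symm
      nth_rewrite 1 [this]
      rw [inner_sub_left, inner_smul_left, Complex.conj_ofReal, hK]
    have e2 : ⟪S l x, x⟫ = ⟪S l x, S m x⟫ - m * ⟪S l x, K (S m x)⟫ := by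
      have : x = S m x - (m : ℂ) • K (S m x) :=
        eq_sub_of_add_eq (hy m hm).symm
      nth_rewrite 2 [this]
      rw [inner_sub_right, inner_smul_right]
    have e3 : (⟪x, S l x⟫).re = (⟪S l x, x⟫).re := by
      rw [← inner_conj_symm, Complex.conj_re]
    rw [e3, e1, e2]
    simp only [Complex.sub_re, Complex.re_ofReal_mul]
    ring
  have hderiv : ∀ l ∈ Λ, HasDerivWithinAt F (‖S l x‖ ^ 2) Λ l := by
    intro l hl
    rw [hasDerivWithinAt_iff_tendsto_slope]
    have t : Tendsto (fun m => (⟪S l x, S m x⟫).re) (𝓝[Λ \ {l}] l) (𝓝 (‖S l x‖ ^ 2)) := by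
      have h := (hcont l hl).mono_left (nhdsWithin_mono l (Set.sdiff_subset (t := {l})))
      have h2 := (Complex.continuous_re.tendsto _).comp
        ((tendsto_const_nhds (x := S l x)).inner (𝕜 := ℂ) h)
      have e : (⟪S l x, S l x⟫).re = ‖S l x‖ ^ 2 := inner_self_eq_norm_sq (𝕜 := ℂ) (S l x)
      rw [e] at h2
      exact h2
    refine t.congr' ?_
    filter_upwards [self_mem_nhdsWithin] with m hm
    have hne : m - l ≠ 0 := sub_ne_zero.2 hm.2
    rw [slope_def_field, hFd l hl m hm.1]
    field_simp
  have hconv : Convex ℝ Λ := hΛ.convex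
  have hc : ContinuousOn F Λ := fun l hl => (hderiv l hl).continuousWithinAt
  have hd : ∀ l ∈ interior Λ, HasDerivAt F (‖S l x‖ ^ 2) l := fun l hl =>
    (hderiv l (interior_subset hl)).hasDerivAt (mem_interior_iff_mem_nhds.1 hl)
  refine ⟨monotoneOn_of_deriv_nonneg hconv hc
    (fun l hl => (hd l hl).differentiableAt.differentiableWithinAt) ?_, fun hx0 =>
    strictMonoOn_of_deriv_pos hconv hc ?_⟩
  · intro l hl
    rw [(hd l hl).deriv]; positivity
  · intro l hl
    rw [(hd l hl).deriv]
    have : S l x ≠ 0 := by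
      intro h
      have := hy l (interior_subset hl)
      rw [h] at this
      simp at this
      exact hx0 this.symm
    positivity

end helpers

/- Monotonicity lemma.  Let `Λ` be a real interval with `Λ ∩ σ_ess(A_N) = ∅`, and
let `v ∈ H¹_A` (with `A v = fv`) satisfy `χ_Λ(A_N) P'_N(0) v = 0`, where
`P'_N(0) v = v - A_N⁻¹ A v = v - TN fv =: w₀`.  (Since `Λ` contains no essential
spectrum, `χ_Λ(A_N) w₀ = 0` is equivalent to `E_N(l) (J w₀) = 0` for all `l ∈ Λ`.)
Then `P'_N(l) v ∈ G_l` for all `l ∈ Λ`, and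
`b[P'_N(l)v] = b[w₀] + l ‖w₀‖² + l² (R_N(l) w₀, w₀)` (with `b[w₀] = a[w₀]`),
so `l ↦ b[P'_N(l)v]` is nondecreasing on `Λ`, and strictly increasing when
`v ∉ D(A_N)`.  `EN l` is the eigenprojection of `A_N` at `l` and `RL l` the
reduced resolvent `R_N(l) E'_N(l) : H → H1`. -/
theorem stmt18
    (J : H1 →L[ℂ] H) (hJinj : Function.Injective J) (hJdense : DenseRange J)
    (H0 : Submodule ℂ H1) [CompleteSpace H0]
    (hH0dense : DenseRange (fun v : H0 => J v))
    (TN : H →L[ℂ] H1) (hTN : ∀ (u : H) (v : H1), ⟪TN u, v⟫ = ⟪u, J v⟫)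
    (Λ : Set ℝ) (hΛ : Λ.OrdConnected)
    (hess : ∀ l ∈ Λ, ¬ InEssSpec (J.comp TN) l)
    (EN : ℝ → (H →L[ℂ] H))
    (hENsa : ∀ l, IsSelfAdjoint (EN l)) (hENidem : ∀ l, IsIdempotentElem (EN l))
    (hENrange : ∀ (l : ℝ) (x : H), EN l x = x ↔ J (TN ((l : ℂ) • x)) = x)
    (RL : ℝ → (H →L[ℂ] H1))
    (hRL0 : ∀ l ∈ Λ, ∀ f : H, RL l (EN l f) = 0)
    (hRLres : ∀ l ∈ Λ, ∀ f : H, TN ((f - EN l f) + (l : ℂ) • J (RL l f)) = RL l f)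
    (hRLperp : ∀ l ∈ Λ, ∀ f : H, EN l (J (RL l f)) = 0)
    (v : H1) (fv : H) (hv : MemA J H0 v fv)
    -- `χ_Λ(A_N) P'_N(0) v = 0`:
    (hchi : ∀ l ∈ Λ, EN l (J (v - TN fv)) = 0) :
    -- `P'_N(l) v ∈ G_l` for all `l ∈ Λ`
    (∀ l ∈ Λ, MemA J H0 (v - RL l (fv - (l : ℂ) • J v))
        ((l : ℂ) • J (v - RL l (fv - (l : ℂ) • J v)))) ∧
    -- the explicit formula for `b[P'_N(l) v]`
    (∀ l ∈ Λ, ∀ p : H1, p = v - RL l (fv - (l : ℂ) • J v) →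
      ⟪p, p⟫ - (l : ℂ) * ⟪J p, J p⟫
        = ⟪v - TN fv, v - TN fv⟫ + (l : ℂ) * ⟪J (v - TN fv), J (v - TN fv)⟫
          + (l : ℂ) ^ 2 * ⟪J (v - TN fv), J (RL l (J (v - TN fv)))⟫) ∧
    -- `l ↦ b[P'_N(l) v]` is nondecreasing on `Λ`
    MonotoneOn (fun l : ℝ =>
      (⟪v - RL l (fv - (l : ℂ) • J v), v - RL l (fv - (l : ℂ) • J v)⟫
        - (l : ℂ) * ⟪J (v - RL l (fv - (l : ℂ) • J v)),
            J (v - RL l (fv - (l : ℂ) • J v))⟫).re) Λ ∧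
    -- and strictly increasing if `v ∉ D(A_N)`
    ((v ∉ Set.range fun g : H => TN g) → StrictMonoOn (fun l : ℝ =>
      (⟪v - RL l (fv - (l : ℂ) • J v), v - RL l (fv - (l : ℂ) • J v)⟫
        - (l : ℂ) * ⟪J (v - RL l (fv - (l : ℂ) • J v)),
            J (v - RL l (fv - (l : ℂ) • J v))⟫).re) Λ) := by
  have hKsym : ∀ u z : H, ⟪J (TN u), z⟫ = ⟪u, J (TN z)⟫ := by
    intro u z
    rw [← inner_conj_symm, ← hTN, inner_conj_symm, hTN]
  have hE1 : ∀ (l : ℝ) (x : H), EN l x = x ↔ (l : ℂ) • (J.comp TN) x = x := by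
    intro l x
    rw [hENrange]
    simp
  have hEE : ∀ (l : ℝ) (f : H), (l : ℂ) • J (TN (EN l f)) = EN l f := by
    intro l f
    have h : EN l (EN l f) = EN l f := by
      have := hENidem l
      exact congrArg (fun T : H →L[ℂ] H => T f) this
    exact (hE1 l _).1 h
  have hEsym : ∀ (l : ℝ) (u z : H), ⟪EN l u, z⟫ = ⟪u, EN l z⟫ := by
    intro l u z
    have := (ContinuousLinearMap.isSelfAdjoint_iff_isSymmetric.1 (hENsa l)) u z
    exact this
  have hE2 : ∀ (l : ℝ) (f : H), (l : ℂ) • EN l (J (TN f)) = EN l f := by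
    intro l f
    refine ext_inner_right ℂ fun z => ?_
    rw [inner_smul_left, hEsym, hKsym, Complex.conj_ofReal, ← inner_smul_right, hEE, hEsym]
  set w := v - TN fv with hw
  have hr : ∀ l ∈ Λ, ∀ g : H, EN l g = 0 → RL l g = TN (g + (l : ℂ) • J (RL l g)) := by
    intro l hl g hg
    have := hRLres l hl g
    rw [hg, sub_zero] at this
    exact this.symm
  -- the decomposition of `P'_N(l) v`
  have hp : ∀ l ∈ Λ, v - RL l (fv - (l : ℂ) • J v)
      = w + TN (EN l fv) + (l : ℂ) • RL l (J w) := by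
    intro l hl
    have hg0 : EN l (fv - (l : ℂ) • J (TN fv)) = 0 := by
      rw [map_sub, map_smul, hE2, sub_self]
    have hu := hr l hl _ hg0
    have hu2 := hRLperp l hl (fv - (l : ℂ) • J (TN fv))
    set u := RL l (fv - (l : ℂ) • J (TN fv)) with hudef
    have key : u = TN (fv - EN l fv) := by
      rw [← sub_eq_zero]
      apply hJinj
      rw [map_zero]
      apply aux_uniq (EN l) (J.comp TN) l (hE1 l)
      · have h1 : EN l (J (TN (fv - EN l fv))) = 0 := by
          have h0 : EN l (EN l fv) = EN l fv := by
            exact congrArg (fun T : H →L[ℂ] H => T fv) (hENidem l)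
          have h3 := hE2 l (fv - EN l fv)
          rw [map_sub (EN l), h0, sub_self] at h3
          rcases smul_eq_zero.1 h3 with h | h
          · set q := EN l (J (TN (fv - EN l fv))) with hq
            have := hEE l (J (TN (fv - EN l fv)))
            rw [h, zero_smul] at this
            exact this.symm
          · exact h
        rw [map_sub, map_sub, hu2, h1, sub_zero]
      · have e := hEE l fv
        have e2 : TN (fv - (l : ℂ) • J (TN fv) + (l : ℂ) • J u) - TN (fv - EN l fv)
            = (l : ℂ) • TN (J (u - TN (fv - EN l fv))) := by
          rw [← map_sub, ← map_smul TN]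
          congr 1
          simp only [map_sub, smul_sub]
          rw [e]
          abel
        nth_rewrite 1 [hu]
        rw [e2]
        simp
    have : fv - (l : ℂ) • J v = (fv - (l : ℂ) • J (TN fv)) - (l : ℂ) • J w := by
      rw [hw, map_sub, smul_sub]; abel
    rw [this, map_sub, map_smul, ← hudef, key, hw, map_sub]
    abel
  have hB : ∀ l ∈ Λ, ∀ z : H1, ⟪RL l (J w), z⟫ = ⟪J w, J z⟫ + l * ⟪J (RL l (J w)), J z⟫ := by
    intro l hl z
    nth_rewrite 1 [hr l hl _ (hchi l hl)]
    rw [hTN, inner_add_left, inner_smul_left, Complex.conj_ofReal]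
  have hform : ∀ l ∈ Λ, ∀ p : H1, p = v - RL l (fv - (l : ℂ) • J v) →
      ⟪p, p⟫ - (l : ℂ) * ⟪J p, J p⟫
        = ⟪w, w⟫ + (l : ℂ) * ⟪J w, J w⟫
          + (l : ℂ) ^ 2 * ⟪J w, J (RL l (J w))⟫ := by
    intro l hl p hpp
    rw [hp l hl] at hpp
    set r := RL l (J w) with hrdef
    set e := TN (EN l fv) with he
    have b1 : ∀ z : H1, ⟪e, z⟫ = l * ⟪J e, J z⟫ := by
      intro z
      rw [he, hTN]
      nth_rewrite 1 [← hEE l fv]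
      rw [inner_smul_left, Complex.conj_ofReal]
    have b1' : ∀ z : H1, ⟪z, e⟫ = l * ⟪J z, J e⟫ := by
      intro z
      rw [← inner_conj_symm, b1, map_mul, Complex.conj_ofReal, inner_conj_symm]
    have b2 := hB l hl
    rw [← hrdef] at b2
    have b2' : ∀ z : H1, ⟪z, r⟫ = ⟪J z, J w⟫ + l * ⟪J z, J r⟫ := by
      intro z
      rw [← inner_conj_symm, b2, map_add, map_mul, Complex.conj_ofReal, inner_conj_symm,
        inner_conj_symm]
    rw [hpp]
    simp only [map_add, map_smul, inner_add_left, inner_add_right, inner_smul_left,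
      inner_smul_right, Complex.conj_ofReal]
    rw [b1 w, b1 e, b1 r, b1' w, b1' r, b2 w, b2' w, b2 r]
    ring
  have hmain := aux_core (J.comp TN) EN
    (fun l => ContinuousLinearMap.id ℂ H + (l : ℂ) • J.comp (RL l)) Λ hΛ hKsym hE1 hE2
    (by
      intro l hl g hg
      have h := hr l hl g hg
      simp only [add_apply, smul_apply,
        ContinuousLinearMap.comp_apply, ContinuousLinearMap.id_apply]
      rw [← h])
    (by
      intro l hl g hg
      simp only [add_apply, smul_apply,
        ContinuousLinearMap.comp_apply, ContinuousLinearMap.id_apply]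
      rw [map_add, map_smul, hg, hRLperp l hl, smul_zero, add_zero])
    (J w) hchi (⟪w, w⟫).re
    (fun l : ℝ =>
      (⟪v - RL l (fv - (l : ℂ) • J v), v - RL l (fv - (l : ℂ) • J v)⟫
        - (l : ℂ) * ⟪J (v - RL l (fv - (l : ℂ) • J v)),
            J (v - RL l (fv - (l : ℂ) • J v))⟫).re)
    (by
      intro l hl
      beta_reduce
      rw [hform l hl _ rfl]
      simp only [add_apply, smul_apply,
        ContinuousLinearMap.comp_apply, ContinuousLinearMap.id_apply, inner_add_right,
        inner_smul_right]
      rw [pow_two, mul_assoc]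
      simp only [Complex.add_re, Complex.re_ofReal_mul]
      ring)
  refine ⟨?_, hform, hmain.1, fun hvn => hmain.2 ?_⟩
  · intro l hl z hz
    rw [hp l hl]
    have e1 : ⟪w, z⟫ = 0 := by
      rw [hw, inner_sub_left, hv z hz, hTN, sub_self]
    have e2 : (l : ℂ) • J (w + TN (EN l fv) + (l : ℂ) • RL l (J w))
        = (l : ℂ) • J w + EN l fv + (l : ℂ) • (l : ℂ) • J (RL l (J w)) := by
      rw [map_add, map_add, smul_add, smul_add, hEE, map_smul]
    rw [e2]
    simp only [inner_add_left, inner_smul_left, Complex.conj_ofReal]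
    rw [e1, hTN, hB l hl]
    ring
  · intro h0
    apply hvn
    have : w = 0 := hJinj (by rw [h0, map_zero])
    exact ⟨fv, (sub_eq_zero.1 this).symm⟩

end
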